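/- Let Ω = S^d, the unit sphere in ℝ^{d+1}, equipped with d-dimensional Hausdorff measure, and let k(x,y) = f(|x−y|) be a kernel on Ω×Ω satisfying the standing assumptions. Then there exists a spherical cap C = { x ∈ S^d : ⟨x, e⟩ ≥ c } (for some unit vector e ∈ ℝ^{d+1} and c ∈ [−1,1]) with ρ_+ |C|_d + ρ_− |S^d ∖ C|_d = 1, such that the density ρ* := ρ_+ 1_C + ρ_− 1_{S^d ∖ C} belongs to A(Ω, ρ_+, ρ_−) and satisfies E[ρ*] ≥ E[ρ] for every ρ ∈ A(Ω, ρ_+, ρ_−). -/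

import Mathlib

noncomputable section

open MeasureTheory Metric Set Filter
open scoped ENNReal NNReal Topology RealInnerProductSpace

/-- The energy `E[ρ] = (1/2) ∫_{Ω×Ω} k(x,y) ρ(x) ρ(y) dx dy`. -/
def energy {α : Type} [MeasurableSpace α] (μ : Measure α) (Ω : Set α)
    (k : α → α → ℝ) (ρ : α → ℝ) : ℝ :=
  (1/2 : ℝ) * ∫ x in Ω, (∫ y in Ω, k x y * ρ x * ρ y ∂μ) ∂μ

/-- The admissible class `A(Ω, ρ₊, ρ₋)`. -/
def IsAdmissible {α : Type} [MeasurableSpace α] (μ : Measure α) (Ω : Set α)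
    (ρp ρm : ℝ) (ρ : α → ℝ) : Prop :=
  AEStronglyMeasurable ρ (μ.restrict Ω) ∧ (∫ x in Ω, ρ x ∂μ) = 1 ∧
  ∀ᵐ x ∂(μ.restrict Ω), ρm ≤ ρ x ∧ ρ x ≤ ρp

/-- `f` is completely monotone on `(0, ∞)`. -/
def CompletelyMonotone (f : ℝ → ℝ) : Prop :=
  ContDiffOn ℝ (⊤ : ℕ∞) f (Set.Ioi 0) ∧
  ∀ (ℓ : ℕ), ∀ t ∈ Set.Ioi (0:ℝ), 0 ≤ (-1:ℝ) ^ ℓ * iteratedDerivWithin ℓ f (Set.Ioi 0) t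

/-- `k` is a positive definite kernel on `Ω`. -/
def IsPosDefKernel {α : Type} (Ω : Set α) (k : α → α → ℝ) : Prop :=
  ∀ (N : ℕ) (x : Fin N → α), (∀ i, x i ∈ Ω) → Function.Injective x →
    ∀ c : Fin N → ℂ, c ≠ 0 →
      0 < (∑ j, ∑ l, c j * (starRingEnd ℂ) (c l) * (k (x j) (x l) : ℂ)).re

section partA


open MeasureTheory Metric Set Filter
open scoped ENNReal NNReal Topology RealInnerProductSpace

/-- A reflection of a metric measure space, compatible with a height function `h`. -/
structure Refl {X : Type} [MetricSpace X] [MeasurableSpace X] (ν : Measure X) (h : X → ℝ) where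
  σ : X → X
  p : X → ℝ
  invol : ∀ x, σ (σ x) = x
  iso : ∀ x y, dist (σ x) (σ y) = dist x y
  mp : MeasurePreserving σ ν ν
  p_neg : ∀ x, p (σ x) = - p x
  fixed : ∀ x, p x = 0 → σ x = x
  closer : ∀ x y, 0 ≤ p x → 0 ≤ p y → dist x y ≤ dist x (σ y)
  height : ∀ x, 0 < p x → h (σ x) < h x

namespace Refl

variable {X : Type} [MetricSpace X] [MeasurableSpace X] {ν : Measure X} {h : X → ℝ}

/-- Two-point symmetrization. -/
def pol (r : Refl ν h) (u : X → ℝ) (x : X) : ℝ :=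
  if 0 ≤ r.p x then max (u x) (u (r.σ x)) else min (u x) (u (r.σ x))

/-- The reflection as a measurable equivalence. -/
def equiv (r : Refl ν h) : X ≃ᵐ X where
  toFun := r.σ
  invFun := r.σ
  left_inv := r.invol
  right_inv := r.invol
  measurable_toFun := r.mp.measurable
  measurable_invFun := r.mp.measurable

lemma dist_swap (r : Refl ν h) (x y : X) : dist (r.σ x) y = dist x (r.σ y) := by
  rw [← r.iso, r.invol]

lemma closer_neg (r : Refl ν h) (x y : X) (hx : r.p x ≤ 0) (hy : r.p y ≤ 0) :
    dist x y ≤ dist x (r.σ y) := by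
  have := r.closer (r.σ x) (r.σ y) (by rw [r.p_neg]; linarith) (by rw [r.p_neg]; linarith)
  rw [r.iso, r.invol, r.dist_swap] at this
  exact this

lemma farther (r : Refl ν h) (x y : X) (hx : 0 ≤ r.p x) (hy : r.p y ≤ 0) :
    dist x (r.σ y) ≤ dist x y := by
  have := r.closer x (r.σ y) hx (by rw [r.p_neg]; linarith)
  rwa [r.invol] at this

lemma farther' (r : Refl ν h) (x y : X) (hx : r.p x ≤ 0) (hy : 0 ≤ r.p y) :
    dist x (r.σ y) ≤ dist x y := by
  have := r.farther y x hy hx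
  rw [← r.dist_swap, dist_comm, dist_comm x y]; rw [← r.dist_swap] at this
  rw [r.dist_swap] at this ; rw [dist_comm, r.dist_swap, dist_comm] ; rw [dist_comm, ← r.dist_swap, dist_comm]
  exact this

lemma pol_pos (r : Refl ν h) (u : X → ℝ) {x : X} (hx : 0 ≤ r.p x) :
    r.pol u x = max (u x) (u (r.σ x)) ∧ r.pol u (r.σ x) = min (u x) (u (r.σ x)) := by
  refine ⟨by simp [pol, hx], ?_⟩
  rcases hx.lt_or_eq with h1 | h1
  · simp [pol, r.p_neg, r.invol, not_le.2 h1, min_comm]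
  · simp [pol, r.fixed x h1.symm]

lemma pol_neg (r : Refl ν h) (u : X → ℝ) {x : X} (hx : r.p x ≤ 0) :
    r.pol u x = min (u x) (u (r.σ x)) ∧ r.pol u (r.σ x) = max (u x) (u (r.σ x)) := by
  have := r.pol_pos u (x := r.σ x) (by rw [r.p_neg]; linarith)
  rw [r.invol] at this
  rw [min_comm, max_comm]
  exact this.symm

lemma pol_modulus (r : Refl ν h) (u : X → ℝ) {δ ε : ℝ}
    (hu : ∀ x y, dist x y ≤ δ → |u x - u y| ≤ ε) :
    ∀ x y, dist x y ≤ δ → |r.pol u x - r.pol u y| ≤ ε := by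
  intro x y hxy
  have e1 := abs_le.1 (hu x y hxy)
  have e2 := abs_le.1 (hu (r.σ x) (r.σ y) (by rwa [r.iso]))
  have key : dist x (r.σ y) ≤ dist x y → |u x - u (r.σ y)| ≤ ε ∧ |u (r.σ x) - u y| ≤ ε :=
    fun h1 => ⟨hu _ _ (h1.trans hxy), hu _ _ (by rw [r.dist_swap]; exact h1.trans hxy)⟩
  rw [abs_le]
  rcases le_total 0 (r.p x) with hx | hx <;> rcases le_total 0 (r.p y) with hy | hy
  · rw [(r.pol_pos u hx).1, (r.pol_pos u hy).1]
    grind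
  · rw [(r.pol_pos u hx).1, (r.pol_neg u hy).1]
    obtain ⟨e3, e4⟩ := key (r.farther x y hx hy)
    rw [abs_le] at e3 e4
    grind
  · rw [(r.pol_neg u hx).1, (r.pol_pos u hy).1]
    obtain ⟨e3, e4⟩ := key (r.farther' x y hx hy)
    rw [abs_le] at e3 e4
    grind
  · rw [(r.pol_neg u hx).1, (r.pol_neg u hy).1]
    grind

lemma pol_continuous [CompactSpace X] (r : Refl ν h) {u : X → ℝ} (hu : Continuous u) :
    Continuous (r.pol u) := by
  have huc := CompactSpace.uniformContinuous_of_continuous hu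
  rw [Metric.uniformContinuous_iff] at huc
  rw [Metric.continuous_iff]
  intro x ε hε
  obtain ⟨δ, hδ, H⟩ := huc (ε / 2) (by linarith)
  refine ⟨δ / 2, by linarith, fun y hy => ?_⟩
  have := r.pol_modulus u (δ := δ / 2) (ε := ε / 2)
    (fun a b hab => (H (lt_of_le_of_lt hab (by linarith))).le) y x hy.le
  rw [Real.dist_eq]; linarith

lemma integral_comp (r : Refl ν h) (F : X → ℝ) : ∫ x, F (r.σ x) ∂ν = ∫ x, F x ∂ν :=
  r.mp.integral_comp r.equiv.measurableEmbedding F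

lemma integrable_comp (r : Refl ν h) {F : X → ℝ} (hF : Integrable F ν) :
    Integrable (fun x => F (r.σ x)) ν :=
  (r.mp.integrable_comp_emb r.equiv.measurableEmbedding).2 hF

lemma sym2 (r : Refl ν h) {F : X → ℝ} (hF : Integrable F ν) :
    2 * ∫ x, F x ∂ν = ∫ x, (F x + F (r.σ x)) ∂ν := by
  rw [integral_add hF (r.integrable_comp hF), r.integral_comp]; ring

lemma sym4 [IsFiniteMeasure ν] (r : Refl ν h) {F : X × X → ℝ} (hF : Integrable F (ν.prod ν)) :
    4 * ∫ z, F z ∂(ν.prod ν) = ∫ z, ((F z + F (r.σ z.1, z.2)) +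
      (F (z.1, r.σ z.2) + F (r.σ z.1, r.σ z.2))) ∂(ν.prod ν) := by
  have m1 : MeasurePreserving (Prod.map r.σ id) (ν.prod ν) (ν.prod ν) :=
    r.mp.prod (MeasurePreserving.id ν)
  have m2 : MeasurePreserving (Prod.map id r.σ) (ν.prod ν) (ν.prod ν) :=
    (MeasurePreserving.id ν).prod r.mp
  have m3 : MeasurePreserving (Prod.map r.σ r.σ) (ν.prod ν) (ν.prod ν) := r.mp.prod r.mp
  have b1 : MeasurableEmbedding (Prod.map r.σ (id : X → X)) :=
    (r.equiv.prodCongr (MeasurableEquiv.refl X)).measurableEmbedding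
  have b2 : MeasurableEmbedding (Prod.map (id : X → X) r.σ) :=
    ((MeasurableEquiv.refl X).prodCongr r.equiv).measurableEmbedding
  have b3 : MeasurableEmbedding (Prod.map r.σ r.σ) :=
    (r.equiv.prodCongr r.equiv).measurableEmbedding
  have i1 := (m1.integrable_comp_emb b1).2 hF
  have i2 := (m2.integrable_comp_emb b2).2 hF
  have i3 := (m3.integrable_comp_emb b3).2 hF
  have j1 := m1.integral_comp b1 F
  have j2 := m2.integral_comp b2 F
  have j3 := m3.integral_comp b3 F
  have := integral_add (hF.add i1) (i2.add i3)
  simp only [Pi.add_apply] at this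
  rw [integral_add hF i1, integral_add i2 i3] at this
  simp only [Function.comp_apply, Prod.map, id] at this j1 j2 j3
  rw [this, j1, j2, j3]; ring

end Refl

end partA

section partB


open MeasureTheory Metric Set Filter
open scoped ENNReal NNReal Topology RealInnerProductSpace BoundedContinuousFunction

set_option linter.unusedSectionVars false
section abstractpart

variable {X : Type} [MetricSpace X] [CompactSpace X] [MeasurableSpace X] [BorelSpace X]

/-- The kernel bilinear form. -/
def bil (ν : Measure X) (K : X → X → ℝ) (u v : X → ℝ) : ℝ :=
  ∫ z, K z.1 z.2 * u z.1 * v z.2 ∂(ν.prod ν)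

lemma kernel_bound {K : X → X → ℝ} (hK : Continuous (Function.uncurry K)) :
    ∃ M, 0 ≤ M ∧ ∀ x y, |K x y| ≤ M := by
  obtain ⟨M, hM⟩ := isCompact_univ.exists_bound_of_continuousOn (f := Function.uncurry K)
    hK.continuousOn
  exact ⟨max M 0, le_max_right _ _, fun x y => (hM (x, y) (mem_univ _)).trans (le_max_left _ _)⟩

lemma bdd_integrable {Y : Type*} [MeasurableSpace Y] {m : Measure Y} [IsFiniteMeasure m]
    {F : Y → ℝ} (hF : Measurable F) {M : ℝ} (hM : ∀ y, |F y| ≤ M) : Integrable F m :=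
  Integrable.of_bound hF.aestronglyMeasurable M (ae_of_all _ hM)

lemma bil_bound {K : X → X → ℝ} {M : ℝ} (hM : ∀ x y, |K x y| ≤ M) {u v : X → ℝ} {b b' : ℝ}
    (hu : ∀ x, |u x| ≤ b) (hv : ∀ x, |v x| ≤ b') (x y : X) :
    |K x y * u x * v y| ≤ M * b * b' := by
  rw [abs_mul, abs_mul]
  have h1 := hM x y
  have h2 := hu x
  have h3 := hv y
  have := abs_nonneg (K x y)
  have := abs_nonneg (u x)
  have := abs_nonneg (v y)
  have hM0 : 0 ≤ M := by linarith
  have hb0 : 0 ≤ b := by linarith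
  gcongr

lemma bil_integrable {ν : Measure X} [IsFiniteMeasure ν] {K : X → X → ℝ}
    (hK : Continuous (Function.uncurry K)) {u v : X → ℝ} (hu : Measurable u) (hv : Measurable v)
    {b b' : ℝ} (hub : ∀ x, |u x| ≤ b) (hvb : ∀ x, |v x| ≤ b') :
    Integrable (fun z : X × X => K z.1 z.2 * u z.1 * v z.2) (ν.prod ν) := by
  obtain ⟨M, _, hM⟩ := kernel_bound hK
  refine bdd_integrable (M := M * b * b') ?_ (fun z => bil_bound hM hub hvb z.1 z.2)
  have : Measurable (fun z : X × X => K z.1 z.2) := hK.measurable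
  exact (this.mul (hu.comp measurable_fst)).mul (hv.comp measurable_snd)

/-- The potential. -/
def pot (ν : Measure X) (K : X → X → ℝ) (v : X → ℝ) (x : X) : ℝ := ∫ y, K x y * v y ∂ν

lemma bil_eq {ν : Measure X} [IsFiniteMeasure ν] {K : X → X → ℝ}
    (hK : Continuous (Function.uncurry K)) {u v : X → ℝ} (hu : Measurable u) (hv : Measurable v)
    {b b' : ℝ} (hub : ∀ x, |u x| ≤ b) (hvb : ∀ x, |v x| ≤ b') :
    bil ν K u v = ∫ x, u x * pot ν K v x ∂ν := by
  unfold bil pot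
  rw [integral_prod _ (bil_integrable hK hu hv hub hvb)]
  congr 1 with x
  rw [← integral_const_mul]
  congr 1 with y
  ring

lemma bil_symm {ν : Measure X} [IsFiniteMeasure ν] {K : X → X → ℝ}
    (hs : ∀ x y, K x y = K y x) (u v : X → ℝ) : bil ν K u v = bil ν K v u := by
  unfold bil
  rw [← integral_prod_swap]
  congr 1 with z
  simp only [Prod.fst_swap, Prod.snd_swap]
  rw [hs]; ring

lemma kv_measurable {K : X → X → ℝ}
    (hK : Continuous (Function.uncurry K)) {v : X → ℝ} (hv : Measurable v) :
    Measurable (fun z : X × X => K z.1 z.2 * v z.2) :=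
  Measurable.mul (show Measurable (fun z : X × X => K z.1 z.2) from hK.measurable)
    (hv.comp measurable_snd)

lemma pot_measurable {ν : Measure X} [IsFiniteMeasure ν] {K : X → X → ℝ}
    (hK : Continuous (Function.uncurry K)) {v : X → ℝ} (hv : Measurable v) :
    Measurable (pot ν K v) :=
  (StronglyMeasurable.integral_prod_right (ν := ν) (f := fun x y => K x y * v y)
    (kv_measurable hK hv).stronglyMeasurable).measurable

lemma pot_bound {ν : Measure X} [IsFiniteMeasure ν] {K : X → X → ℝ} {M b : ℝ}
    (hM : ∀ x y, |K x y| ≤ M) {v : X → ℝ}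
    (hvb : ∀ x, |v x| ≤ b) (x : X) : |pot ν K v x| ≤ M * b * ν.real univ := by
  have := norm_integral_le_of_norm_le_const (μ := ν) (f := fun y => K x y * v y) (C := M * b)
    (ae_of_all _ fun y => by
      rw [Real.norm_eq_abs, abs_mul]
      have := hM x y
      have := hvb y
      have := abs_nonneg (K x y)
      gcongr; linarith)
  simpa [pot] using this

/-- Potentials of functions monotone in height are monotone in height. -/
lemma pot_mono {ν : Measure X} [IsFiniteMeasure ν] {K : X → X → ℝ}
    (hK : Continuous (Function.uncurry K))
    (hKd : ∀ x y x' y', dist x y ≤ dist x' y' → K x' y' ≤ K x y)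
    {h : X → ℝ} (hr : ∀ x y, h y < h x → ∃ r : Refl ν h, r.σ x = y ∧ 0 < r.p x)
    {v : X → ℝ} (hv : Measurable v) {b : ℝ} (hvb : ∀ x, |v x| ≤ b)
    (hmono : ∀ x y, h y < h x → v y ≤ v x) (x y : X) (hxy : h y < h x) :
    pot ν K v y ≤ pot ν K v x := by
  obtain ⟨r, rfl, hp⟩ := hr x y hxy
  obtain ⟨M, hM0, hM⟩ := kernel_bound hK
  have hint : ∀ x, Integrable (fun z => K x z * v z) ν := fun x =>
    bdd_integrable (M := M * b) ((kv_measurable hK hv).comp measurable_prodMk_left) (fun y => by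
      rw [abs_mul]
      have := hM x y
      have := hvb y
      gcongr)
  have hsw : ∀ z, K x (r.σ z) = K (r.σ x) z := fun z =>
    le_antisymm (hKd _ _ _ _ (by rw [r.dist_swap])) (hKd _ _ _ _ (by rw [r.dist_swap]))
  have hsw' : ∀ z, K (r.σ x) (r.σ z) = K x z := fun z =>
    le_antisymm (hKd _ _ _ _ (by rw [r.iso])) (hKd _ _ _ _ (by rw [r.iso]))
  rw [← sub_nonneg]
  unfold pot
  rw [← integral_sub (hint x) (hint _)]
  have := r.sym2 ((hint x).sub (hint (r.σ x)))
  simp only [Pi.sub_apply] at this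
  have h0 : 0 ≤ ∫ z, (K x z * v z - K (r.σ x) z * v z +
      (K x (r.σ z) * v (r.σ z) - K (r.σ x) (r.σ z) * v (r.σ z))) ∂ν := by
    apply integral_nonneg
    intro z
    simp only [Pi.zero_apply]
    rw [hsw', hsw]
    have e : K x z * v z - K (r.σ x) z * v z + (K (r.σ x) z * v (r.σ z) - K x z * v (r.σ z))
      = (K x z - K (r.σ x) z) * (v z - v (r.σ z)) := by ring
    rw [e, ← hsw]
    rcases lt_trichotomy (r.p z) 0 with hz | hz | hz
    · apply mul_nonneg_of_nonpos_of_nonpos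
      · exact sub_nonpos.2 (hKd _ _ _ _ (r.farther x z hp.le hz.le))
      · apply sub_nonpos.2 (hmono _ _ _)
        have := r.height (r.σ z) (by rw [r.p_neg]; linarith)
        rwa [r.invol] at this
    · rw [r.fixed z hz]; simp
    · apply mul_nonneg
      · exact sub_nonneg.2 (hKd _ _ _ _ (r.closer x z hp.le hz.le))
      · exact sub_nonneg.2 (hmono _ _ (r.height z hz))
  linarith

/-- Bathtub principle with an error term. -/
lemma bathtub {ν : Measure X} [IsFiniteMeasure ν] {h : X → ℝ} (hh : Measurable h) {φ w : X → ℝ}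
    (hφ : Measurable φ) (hw : Measurable w) {M a b : ℝ} (hM : ∀ x, |φ x| ≤ M)
    (hM0 : 0 ≤ M)
    (hwab : ∀ x, a ≤ w x ∧ w x ≤ b) (hmono : ∀ x y, h y < h x → φ y ≤ φ x) (c : ℝ) :
    ∫ x, w x * φ x ∂ν ≤ ∫ x, (if c ≤ h x then b else a) * φ x ∂ν +
      M * |∫ x, (if c ≤ h x then b else a) ∂ν - ∫ x, w x ∂ν| := by
  set s : X → ℝ := fun x => if c ≤ h x then b else a with hs
  have hsm : Measurable s := Measurable.ite (measurableSet_le measurable_const hh)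
    measurable_const measurable_const
  have hsb : ∀ x, |s x| ≤ max |a| |b| := by
    intro x; simp only [hs]; split_ifs
    · exact le_max_right _ _
    · exact le_max_left _ _
  have hwb : ∀ x, |w x| ≤ max |a| |b| := by
    intro x
    have := hwab x
    exact abs_le_max_abs_abs this.1 this.2
  obtain ⟨t, ht, ht1, ht2⟩ : ∃ t, |t| ≤ M ∧ (∀ x, c ≤ h x → t ≤ φ x) ∧
      (∀ x, h x < c → φ x ≤ t) := by
    set T : Set ℝ := insert (-M) (φ '' {x | h x < c})
    have hT : BddAbove T := by
      refine ⟨M, ?_⟩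
      rintro y (rfl | ⟨x, _, rfl⟩)
      · linarith
      · exact (abs_le.1 (hM x)).2
    have hne : T.Nonempty := ⟨-M, mem_insert _ _⟩
    refine ⟨sSup T, abs_le.2 ⟨le_csSup hT (mem_insert _ _), csSup_le hne ?_⟩, ?_, ?_⟩
    · rintro y (rfl | ⟨x, _, rfl⟩)
      · linarith
      · exact (abs_le.1 (hM x)).2
    · intro x hx
      apply csSup_le hne
      rintro y (rfl | ⟨z, hz, rfl⟩)
      · exact (abs_le.1 (hM x)).1
      · exact hmono _ _ (lt_of_lt_of_le hz hx)
    · intro x hx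
      exact le_csSup hT (mem_insert_of_mem _ ⟨x, hx, rfl⟩)
  have is : Integrable s ν := bdd_integrable hsm hsb
  have iw : Integrable w ν := bdd_integrable hw hwb
  have hb0 : 0 ≤ max |a| |b| := (abs_nonneg a).trans (le_max_left _ _)
  have isφ : Integrable (fun x => s x * φ x) ν :=
    bdd_integrable (M := max |a| |b| * M) (hsm.mul hφ) (fun x => by
      rw [abs_mul]; have := hM x; have := hsb x; gcongr)
  have iwφ : Integrable (fun x => w x * φ x) ν :=
    bdd_integrable (M := max |a| |b| * M) (hw.mul hφ) (fun x => by
      rw [abs_mul]; have := hM x; have := hwb x; gcongr)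
  have h0 : 0 ≤ ∫ x, ((s x * φ x - w x * φ x) - t * (s x - w x)) ∂ν := by
    apply integral_nonneg
    intro x
    have e : (s x * φ x - w x * φ x) - t * (s x - w x) = (φ x - t) * (s x - w x) := by ring
    simp only [Pi.zero_apply]
    rw [e]
    rcases le_or_gt c (h x) with hx | hx
    · simp only [hs, hx, if_true]
      exact mul_nonneg (sub_nonneg.2 (ht1 x hx)) (sub_nonneg.2 (hwab x).2)
    · simp only [hs, not_le.2 hx, if_false]
      exact mul_nonneg_of_nonpos_of_nonpos (sub_nonpos.2 (ht2 x hx)) (sub_nonpos.2 (hwab x).1)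
  have e1 : Integrable (fun x => s x * φ x - w x * φ x) ν := isφ.sub iwφ
  have e2 : Integrable (fun x => t * (s x - w x)) ν := (is.sub iw).const_mul t
  rw [integral_sub e1 e2, integral_sub isφ iwφ,
    integral_const_mul, integral_sub is iw] at h0
  have : |t * (∫ x, s x ∂ν - ∫ x, w x ∂ν)| ≤ M * |∫ x, s x ∂ν - ∫ x, w x ∂ν| := by
    rw [abs_mul]; gcongr
  have := (abs_le.1 this).1
  linarith

lemma bil_le_of_mono {ν : Measure X} [IsFiniteMeasure ν] {K : X → X → ℝ}
    (hK : Continuous (Function.uncurry K))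
    (hKd : ∀ x y x' y', dist x y ≤ dist x' y' → K x' y' ≤ K x y)
    {h : X → ℝ} (hh : Measurable h)
    (hr : ∀ x y, h y < h x → ∃ r : Refl ν h, r.σ x = y ∧ 0 < r.p x)
    {M : ℝ} (hM : ∀ x y, |K x y| ≤ M) (hM0 : 0 ≤ M)
    {w : X → ℝ} (hw : Measurable w) {a b : ℝ} (ha : 0 ≤ a) (hab : a ≤ b)
    (hwab : ∀ x, a ≤ w x ∧ w x ≤ b)
    (hmono : ∀ x y, h y < h x → w y ≤ w x) (c : ℝ) :
    bil ν K w w ≤ bil ν K (fun x => if c ≤ h x then b else a) (fun x => if c ≤ h x then b else a) +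
      2 * (M * b * ν.real univ) * |∫ x, (if c ≤ h x then b else a) ∂ν - ∫ x, w x ∂ν| := by
  set s : X → ℝ := fun x => if c ≤ h x then b else a with hs
  have hsm : Measurable s := Measurable.ite (measurableSet_le measurable_const hh)
    measurable_const measurable_const
  have hsb : ∀ x, |s x| ≤ b := by
    intro x; simp only [hs]; split_ifs
    · rw [abs_of_nonneg]; linarith
    · rw [abs_of_nonneg ha]; exact hab
  have hwb : ∀ x, |w x| ≤ b := by
    intro x
    have := hwab x
    rw [abs_of_nonneg] <;> linarith
  have hsmono : ∀ x y, h y < h x → s y ≤ s x := by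
    intro x y hxy
    simp only [hs]
    split_ifs <;> linarith
  have hKs : ∀ x y, K x y = K y x := fun x y =>
    le_antisymm (hKd _ _ _ _ (by rw [dist_comm])) (hKd _ _ _ _ (by rw [dist_comm]))
  have hM1 : 0 ≤ M * b * ν.real univ :=
    mul_nonneg (mul_nonneg hM0 (ha.trans hab)) measureReal_nonneg
  have h1 := bathtub (ν := ν) hh (pot_measurable (ν := ν) hK hw) hw (pot_bound hM hwb) hM1 hwab
    (pot_mono hK hKd hr hw hwb hmono) c
  have h2 := bathtub (ν := ν) hh (pot_measurable (ν := ν) hK hsm) hw (pot_bound hM hsb) hM1 hwab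
    (pot_mono hK hKd hr hsm hsb hsmono) c
  change _ ≤ ∫ x, s x * _ ∂ν + _ * |∫ x, s x ∂ν - _| at h1
  change _ ≤ ∫ x, s x * _ ∂ν + _ * |∫ x, s x ∂ν - _| at h2
  rw [← bil_eq hK hw hw hwb hwb, ← bil_eq hK hsm hw hsb hwb] at h1
  rw [← bil_eq hK hw hsm hwb hsb, ← bil_eq hK hsm hsm hsb hsb] at h2
  rw [bil_symm hKs s w] at h1
  linarith

end abstractpart

end partB

section partC


open MeasureTheory Metric Set Filter
open scoped ENNReal NNReal Topology RealInnerProductSpace BoundedContinuousFunction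

set_option linter.unusedSectionVars false
section abstractpart2

variable {X : Type} [MetricSpace X] [CompactSpace X] [MeasurableSpace X] [BorelSpace X]

lemma two_point_alg (A B a a' c c' : ℝ) (hAB : B ≤ A) :
    A * a * c + B * a' * c + (B * a * c' + A * a' * c') ≤
      A * max a a' * max c c' + B * min a a' * max c c' +
      (B * max a a' * min c c' + A * min a a' * min c c') := by
  rcases le_total a a' with h1 | h1 <;> rcases le_total c c' with h2 | h2 <;>
    simp only [max_eq_left, max_eq_right, min_eq_left, min_eq_right, h1, h2] <;>
    nlinarith [mul_nonneg (sub_nonneg.2 hAB) (mul_nonneg (sub_nonneg.2 h1) (sub_nonneg.2 h2))]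

lemma two_point_alg' (A B a a' c c' : ℝ) (hAB : A ≤ B) :
    A * a * c + B * a' * c + (B * a * c' + A * a' * c') ≤
      A * max a a' * min c c' + B * min a a' * min c c' +
      (B * max a a' * max c c' + A * min a a' * max c c') := by
  have := two_point_alg B A a a' c' c hAB
  rw [max_comm c', min_comm c'] at this
  linarith

lemma bil_pol {ν : Measure X} [IsFiniteMeasure ν] {K : X → X → ℝ}
    (hK : Continuous (Function.uncurry K))
    (hKd : ∀ x y x' y', dist x y ≤ dist x' y' → K x' y' ≤ K x y)
    {h : X → ℝ} (r : Refl ν h) {u : X → ℝ} (hu : Continuous u) :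
    bil ν K u u ≤ bil ν K (r.pol u) (r.pol u) := by
  have hb : ∀ {w : X → ℝ}, Continuous w → ∃ M, ∀ x, |w x| ≤ M := by
    intro w hw
    obtain ⟨M, hM⟩ := isCompact_univ.exists_bound_of_continuousOn hw.continuousOn
    exact ⟨M, fun x => hM x (mem_univ x)⟩
  have hp := r.pol_continuous hu
  obtain ⟨M, hM⟩ := hb hu
  obtain ⟨M', hM'⟩ := hb hp
  have i1 := bil_integrable (ν := ν) hK hu.measurable hu.measurable hM hM
  have i2 := bil_integrable (ν := ν) hK hp.measurable hp.measurable hM' hM'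
  have s1 := r.sym4 i1
  have s2 := r.sym4 i2
  have hsw : ∀ x z, K (r.σ x) z = K x (r.σ z) := fun x z =>
    le_antisymm (hKd _ _ _ _ (by rw [r.dist_swap])) (hKd _ _ _ _ (by rw [r.dist_swap]))
  have hsw' : ∀ x z, K (r.σ x) (r.σ z) = K x z := fun x z =>
    le_antisymm (hKd _ _ _ _ (by rw [r.iso])) (hKd _ _ _ _ (by rw [r.iso]))
  suffices hs : 4 * bil ν K u u ≤ 4 * bil ν K (r.pol u) (r.pol u) by linarith
  unfold bil
  rw [s1, s2]
  have hσ : Continuous r.σ := (Isometry.of_dist_eq r.iso).continuous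
  have hK' : ∀ {f g : X × X → X}, Continuous f → Continuous g → Continuous fun z => K (f z) (g z) :=
    fun hf hg => hK.comp (hf.prodMk hg)
  have hint : ∀ {w : X → ℝ}, Continuous w → Integrable (fun z : X × X =>
      K z.1 z.2 * w z.1 * w z.2 + K (r.σ z.1) z.2 * w (r.σ z.1) * w z.2 +
      (K z.1 (r.σ z.2) * w z.1 * w (r.σ z.2) +
      K (r.σ z.1) (r.σ z.2) * w (r.σ z.1) * w (r.σ z.2))) (ν.prod ν) := by
    intro w hw
    have : Continuous (fun z : X × X =>
      K z.1 z.2 * w z.1 * w z.2 + K (r.σ z.1) z.2 * w (r.σ z.1) * w z.2 +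
      (K z.1 (r.σ z.2) * w z.1 * w (r.σ z.2) +
      K (r.σ z.1) (r.σ z.2) * w (r.σ z.1) * w (r.σ z.2))) := by
      have k1 := hK' (f := fun z => z.1) (g := fun z => z.2) (by fun_prop) (by fun_prop)
      have k2 := hK' (f := fun z => r.σ z.1) (g := fun z => z.2) (by fun_prop) (by fun_prop)
      have k3 := hK' (f := fun z => z.1) (g := fun z => r.σ z.2) (by fun_prop) (by fun_prop)
      have k4 := hK' (f := fun z => r.σ z.1) (g := fun z => r.σ z.2) (by fun_prop) (by fun_prop)
      fun_prop
    obtain ⟨C, hC⟩ := isCompact_univ.exists_bound_of_continuousOn this.continuousOn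
    exact bdd_integrable this.measurable (fun z => hC z (mem_univ z))
  refine integral_mono (hint hu) (hint hp) ?_
  rintro ⟨x, y⟩
  simp only
  rw [hsw', hsw]
  rcases le_total 0 (r.p x) with hx | hx <;> rcases le_total 0 (r.p y) with hy | hy
  · rw [(r.pol_pos u hx).1, (r.pol_pos u hx).2, (r.pol_pos u hy).1, (r.pol_pos u hy).2]
    exact two_point_alg _ _ _ _ _ _ (hKd _ _ _ _ (r.closer x y hx hy))
  · rw [(r.pol_pos u hx).1, (r.pol_pos u hx).2, (r.pol_neg u hy).1, (r.pol_neg u hy).2]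
    exact two_point_alg' _ _ _ _ _ _ (hKd _ _ _ _ (r.farther x y hx hy))
  · rw [(r.pol_neg u hx).1, (r.pol_neg u hx).2, (r.pol_pos u hy).1, (r.pol_pos u hy).2]
    have := two_point_alg' _ _ (u x) (u (r.σ x)) (u y) (u (r.σ y))
      (hKd _ _ _ _ (r.farther' x y hx hy))
    linarith
  · rw [(r.pol_neg u hx).1, (r.pol_neg u hx).2, (r.pol_neg u hy).1, (r.pol_neg u hy).2]
    have := two_point_alg _ _ (u x) (u (r.σ x)) (u y) (u (r.σ y))
      (hKd _ _ _ _ (r.closer_neg x y hx hy))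
    linarith

lemma pol_integral {ν : Measure X} [IsFiniteMeasure ν]
    {h : X → ℝ} (r : Refl ν h) {u : X → ℝ} (hu : Continuous u) :
    ∫ x, r.pol u x ∂ν = ∫ x, u x ∂ν := by
  have hint : ∀ {w : X → ℝ}, Continuous w → Integrable w ν := fun hw =>
    hw.integrable_of_hasCompactSupport (HasCompactSupport.of_compactSpace _)
  have s1 := r.sym2 (hint hu)
  have s2 := r.sym2 (hint (r.pol_continuous hu))
  have : ∀ x, r.pol u x + r.pol u (r.σ x) = u x + u (r.σ x) := by
    intro x
    rcases le_total 0 (r.p x) with hx | hx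
    · rw [(r.pol_pos u hx).1, (r.pol_pos u hx).2, max_add_min]
    · rw [(r.pol_neg u hx).1, (r.pol_neg u hx).2, min_add_max]
  simp only [this] at s2
  linarith

lemma pol_height {ν : Measure X} [IsFiniteMeasure ν] [ν.IsOpenPosMeasure]
    {h : X → ℝ} (hh : Continuous h) (r : Refl ν h) {u : X → ℝ} (hu : Continuous u) {x : X}
    (hx : 0 < r.p x) (hlt : u x < u (r.σ x)) :
    ∫ x, u x * h x ∂ν < ∫ x, r.pol u x * h x ∂ν := by
  have hint : ∀ {w : X → ℝ}, Continuous w → Integrable w ν := fun hw =>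
    hw.integrable_of_hasCompactSupport (HasCompactSupport.of_compactSpace _)
  have hp := r.pol_continuous hu
  have hσ : Continuous r.σ := (Isometry.of_dist_eq r.iso).continuous
  have s1 := r.sym2 (hint (hu.mul hh))
  have s2 := r.sym2 (hint (hp.mul hh))
  have hc1 : Continuous fun x => u x * h x + u (r.σ x) * h (r.σ x) := by fun_prop
  have hc2 : Continuous fun x => r.pol u x * h x + r.pol u (r.σ x) * h (r.σ x) := by fun_prop
  have key : 0 < ∫ x, ((r.pol u x * h x + r.pol u (r.σ x) * h (r.σ x)) -
      (u x * h x + u (r.σ x) * h (r.σ x))) ∂ν := by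
    refine (hc2.sub hc1).integral_pos_of_hasCompactSupport_nonneg_nonzero (x := x)
      (HasCompactSupport.of_compactSpace _) ?_ ?_
    · intro z
      simp only [Pi.zero_apply]
      rcases lt_trichotomy (r.p z) 0 with hz | hz | hz
      · rw [(r.pol_neg u hz.le).1, (r.pol_neg u hz.le).2]
        have := r.height (r.σ z) (by rw [r.p_neg]; linarith)
        rw [r.invol] at this
        rcases le_total (u z) (u (r.σ z)) with h1 | h1 <;>
          simp only [max_eq_left, max_eq_right, min_eq_left, min_eq_right, h1] <;> nlinarith
      · rw [(r.pol_neg u hz.le).1, (r.pol_neg u hz.le).2, r.fixed z hz]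
        simp
      · rw [(r.pol_pos u hz.le).1, (r.pol_pos u hz.le).2]
        have := r.height z hz
        rcases le_total (u z) (u (r.σ z)) with h1 | h1 <;>
          simp only [max_eq_left, max_eq_right, min_eq_left, min_eq_right, h1] <;> nlinarith
    · rw [(r.pol_pos u hx.le).1, (r.pol_pos u hx.le).2, max_eq_right hlt.le, min_eq_left hlt.le]
      have := r.height x hx
      apply ne_of_gt
      nlinarith
  rw [integral_sub (hint hc2) (hint hc1)] at key
  simp only [Pi.mul_apply] at s1 s2
  linarith

lemma continuous_integral_bcf {Y : Type*} [MeasurableSpace Y] {m : Measure Y} [IsFiniteMeasure m]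
    (Φ : (X →ᵇ ℝ) → Y → ℝ) (hm : ∀ w, AEStronglyMeasurable (Φ w) m)
    (hc : ∀ y, Continuous fun w => Φ w y)
    (hb : ∀ R, ∃ C, ∀ w : X →ᵇ ℝ, ‖w‖ ≤ R → ∀ y, |Φ w y| ≤ C) :
    Continuous fun w => ∫ y, Φ w y ∂m := by
  rw [continuous_iff_continuousAt]
  intro w₀
  obtain ⟨C, hC⟩ := hb (‖w₀‖ + 1)
  refine continuousAt_of_dominated (bound := fun _ => C) (Eventually.of_forall hm) ?_
    (integrable_const _) (ae_of_all _ fun y => (hc y).continuousAt)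
  have : ∀ᶠ w in 𝓝 w₀, ‖w‖ < ‖w₀‖ + 1 :=
    (continuous_norm.continuousAt (x := w₀)).eventually_lt continuousAt_const (by linarith)
  filter_upwards [this] with w hw
  exact ae_of_all _ fun y => hC w hw.le y

lemma exists_mono {ν : Measure X} [IsFiniteMeasure ν] [ν.IsOpenPosMeasure] {K : X → X → ℝ}
    (hK : Continuous (Function.uncurry K))
    (hKd : ∀ x y x' y', dist x y ≤ dist x' y' → K x' y' ≤ K x y)
    {h : X → ℝ} (hh : Continuous h)
    (hr : ∀ x y, h y < h x → ∃ r : Refl ν h, r.σ x = y ∧ 0 < r.p x)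
    {u : X → ℝ} (hu : Continuous u) {a b : ℝ} (huab : ∀ x, a ≤ u x ∧ u x ≤ b) :
    ∃ w : X → ℝ, Continuous w ∧ (∀ x, a ≤ w x ∧ w x ≤ b) ∧ ∫ x, w x ∂ν = ∫ x, u x ∂ν ∧
      bil ν K u u ≤ bil ν K w w ∧ ∀ x y, h y < h x → w y ≤ w x := by
  obtain ⟨M, hM0, hM⟩ := kernel_bound hK
  obtain ⟨H, hH⟩ := isCompact_univ.exists_bound_of_continuousOn hh.continuousOn
  have hwn : ∀ (w : X →ᵇ ℝ) x, |w x| ≤ ‖w‖ := fun w x => w.norm_coe_le_norm x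
  have c1 : Continuous fun w : X →ᵇ ℝ => ∫ x, w x ∂ν :=
    continuous_integral_bcf (fun w x => w x) (fun w => w.continuous.aestronglyMeasurable)
      (fun y => by fun_prop) (fun R => ⟨R, fun w hw y => (hwn w y).trans hw⟩)
  have c2 : Continuous fun w : X →ᵇ ℝ => bil ν K w w :=
    continuous_integral_bcf (m := ν.prod ν) (fun w (z : X × X) => K z.1 z.2 * w z.1 * w z.2)
      (fun w => (bil_integrable hK w.continuous.measurable w.continuous.measurable
        (hwn w) (hwn w)).aestronglyMeasurable)
      (fun y => by fun_prop) (fun R => ⟨M * R * R, fun w hw y =>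
        bil_bound hM (fun x => (hwn w x).trans hw) (fun x => (hwn w x).trans hw) y.1 y.2⟩)
  have c3 : Continuous fun w : X →ᵇ ℝ => ∫ x, w x * h x ∂ν :=
    continuous_integral_bcf (fun w x => w x * h x)
      (fun w => (w.continuous.mul hh).aestronglyMeasurable)
      (fun y => by fun_prop) (fun R => ⟨R * H, fun w hw y => by
        rw [abs_mul]
        have h1 := (hwn w y).trans hw
        have h2 : |h y| ≤ H := hH y (mem_univ y)
        have := abs_nonneg (w y)
        have : 0 ≤ R := by linarith
        gcongr⟩)
  let A : Set (X →ᵇ ℝ) := {w | (∀ x, w x ∈ Icc a b) ∧ (∀ δ ε : ℝ,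
    (∀ x y, dist x y ≤ δ → |u x - u y| ≤ ε) → ∀ x y, dist x y ≤ δ → |w x - w y| ≤ ε) ∧
    ∫ x, w x ∂ν = ∫ x, u x ∂ν ∧ bil ν K u u ≤ bil ν K w w}
  have hAc : IsClosed A := by
    refine IsClosed.inter (s₁ := {w : X →ᵇ ℝ | ∀ x, w x ∈ Icc a b}) ?_ (IsClosed.inter
      (s₁ := {w : X →ᵇ ℝ | ∀ δ ε : ℝ,
    (∀ x y, dist x y ≤ δ → |u x - u y| ≤ ε) → ∀ x y, dist x y ≤ δ → |w x - w y| ≤ ε}) ?_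
      (IsClosed.inter (s₁ := {w : X →ᵇ ℝ | ∫ x, w x ∂ν = ∫ x, u x ∂ν})
        (isClosed_eq c1 continuous_const) (isClosed_le continuous_const c2)))
    · simp only [setOf_forall]
      exact isClosed_iInter fun x => isClosed_Icc.preimage (by fun_prop)
    · simp only [setOf_forall]
      exact isClosed_iInter fun δ => isClosed_iInter fun ε => isClosed_iInter fun _ =>
        isClosed_iInter fun x => isClosed_iInter fun y => isClosed_iInter fun _ =>
        isClosed_le (by fun_prop) continuous_const
  have hAcomp : IsCompact A := by
    refine BoundedContinuousFunction.arzela_ascoli₂ (Icc a b) isCompact_Icc A hAc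
      (fun f x hf => hf.1 x) ?_
    apply UniformEquicontinuous.equicontinuous
    rw [Metric.uniformEquicontinuous_iff]
    intro ε hε
    have huc := CompactSpace.uniformContinuous_of_continuous hu
    rw [Metric.uniformContinuous_iff] at huc
    obtain ⟨δ, hδ, H⟩ := huc (ε / 2) (by linarith)
    refine ⟨δ / 2, by linarith, fun x y hxy w => ?_⟩
    have := w.2.2.1 (δ / 2) (ε / 2) (fun a b hab => (H (lt_of_le_of_lt hab (by linarith))).le)
      x y hxy.le
    rw [Real.dist_eq]; linarith
  have hne : A.Nonempty := ⟨BoundedContinuousFunction.mkOfCompact ⟨u, hu⟩, by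
    refine ⟨huab, ?_, ?_, ?_⟩
    · intro δ ε hyp; exact hyp
    · rfl
    · exact le_rfl⟩
  obtain ⟨w, hwA, hmax⟩ := hAcomp.exists_isMaxOn hne c3.continuousOn
  refine ⟨w, w.continuous, hwA.1, hwA.2.2.1, hwA.2.2.2, fun x y hxy => ?_⟩
  by_contra! hlt
  obtain ⟨r, rfl, hp⟩ := hr x y hxy
  have hcont := r.pol_continuous w.continuous
  have hmem : BoundedContinuousFunction.mkOfCompact ⟨r.pol w, hcont⟩ ∈ A := by
    refine ⟨fun x => ?_, ?_, ?_, ?_⟩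
    · change r.pol w x ∈ Icc a b
      have h1 := hwA.1 x
      have h2 := hwA.1 (r.σ x)
      unfold Refl.pol
      split_ifs
      · exact ⟨le_max_of_le_left h1.1, max_le h1.2 h2.2⟩
      · exact ⟨le_min h1.1 h2.1, min_le_of_left_le h1.2⟩
    · intro δ ε hyp
      exact r.pol_modulus w (hwA.2.1 δ ε hyp)
    · exact (pol_integral r w.continuous).trans hwA.2.2.1
    · exact hwA.2.2.2.trans (bil_pol hK hKd r w.continuous)
  have h1 := hmax hmem
  have h2 := pol_height hh r w.continuous hp hlt
  exact absurd h1 (not_le.2 h2)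

theorem abstract_max {ν : Measure X} [IsFiniteMeasure ν] [ν.IsOpenPosMeasure] {K : X → X → ℝ}
    (hK : Continuous (Function.uncurry K))
    (hKd : ∀ x y x' y', dist x y ≤ dist x' y' → K x' y' ≤ K x y)
    {h : X → ℝ} (hh : Continuous h)
    (hr : ∀ x y, h y < h x → ∃ r : Refl ν h, r.σ x = y ∧ 0 < r.p x)
    {ρ : X → ℝ} (hρ : Measurable ρ) {a b : ℝ} (ha : 0 ≤ a) (hab : a ≤ b)
    (hρab : ∀ x, a ≤ ρ x ∧ ρ x ≤ b) (c : ℝ)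
    (hmass : ∫ x, ρ x ∂ν = ∫ x, (if c ≤ h x then b else a) ∂ν) :
    bil ν K ρ ρ ≤
      bil ν K (fun x => if c ≤ h x then b else a) (fun x => if c ≤ h x then b else a) := by
  obtain ⟨M, hM0, hM⟩ := kernel_bound hK
  have hb : 0 ≤ b := ha.trans hab
  set D := M * b * ν.real univ with hD
  have hD0 : 0 ≤ D := mul_nonneg (mul_nonneg hM0 hb) measureReal_nonneg
  have hρb : ∀ x, |ρ x| ≤ b := fun x => by
    have := hρab x
    rw [abs_of_nonneg] <;> linarith
  have iρ : Integrable ρ ν := bdd_integrable hρ hρb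
  refine le_of_forall_pos_le_add fun ε hε => ?_
  set η := ε / (4 * D + 1) with hη
  have hη0 : 0 < η := by positivity
  obtain ⟨v, hv, hvi⟩ := iρ.exists_boundedContinuous_integral_sub_le hη0
  set u : X → ℝ := fun x => max a (min b (v x)) with hu
  have huc : Continuous u := by fun_prop
  have huab : ∀ x, a ≤ u x ∧ u x ≤ b := fun x =>
    ⟨le_max_left _ _, max_le hab (min_le_left _ _)⟩
  have hub : ∀ x, |u x| ≤ b := fun x => by
    have := huab x
    rw [abs_of_nonneg] <;> linarith
  have iu : Integrable u ν := bdd_integrable huc.measurable hub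
  have hclose : ∫ x, |ρ x - u x| ∂ν ≤ η := by
    refine le_trans (integral_mono (iρ.sub iu).abs (iρ.sub hvi).norm fun x => ?_) hv
    simp only [Pi.sub_apply, Real.norm_eq_abs]
    have := hρab x
    simp only [hu]
    rw [abs_le]
    constructor <;> grind
  have hbil : bil ν K ρ ρ - bil ν K u u ≤ 2 * D * η := by
    have hKs : ∀ x y, K x y = K y x := fun x y =>
      le_antisymm (hKd _ _ _ _ (by rw [dist_comm])) (hKd _ _ _ _ (by rw [dist_comm]))
    have hum := huc.measurable
    have aux : ∀ {s : X → ℝ}, Measurable s → (∀ x, |s x| ≤ b) →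
        bil ν K ρ s - bil ν K u s ≤ D * η := by
      intro s hs hsb
      rw [bil_eq hK hρ hs hρb hsb, bil_eq hK hum hs hub hsb]
      have hpm := pot_measurable (ν := ν) hK hs
      have hpb := pot_bound (ν := ν) hM hsb
      have j : ∀ {t : X → ℝ}, Measurable t → (∀ x, |t x| ≤ b) →
          Integrable (fun x => t x * pot ν K s x) ν := by
        intro t ht htb
        refine bdd_integrable (M := b * D) (ht.mul hpm) fun x => ?_
        rw [abs_mul]
        have := htb x
        have := hpb x
        gcongr
      rw [← integral_sub (j hρ hρb) (j hum hub)]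
      calc _ ≤ ∫ x, D * |ρ x - u x| ∂ν := by
            refine integral_mono ((j hρ hρb).sub (j hum hub)) ((iρ.sub iu).abs.const_mul D) ?_
            intro x
            simp only [Pi.sub_apply]
            rw [← sub_mul, mul_comm D]
            refine (le_abs_self _).trans ?_
            rw [abs_mul]
            have := hpb x
            gcongr
        _ ≤ D * η := by rw [integral_const_mul]; gcongr
    have h1 := aux hρ hρb
    have h2 := aux hum hub
    rw [bil_symm hKs u ρ] at h1
    linarith
  have hmassu : |∫ x, (if c ≤ h x then b else a) ∂ν - ∫ x, u x ∂ν| ≤ η := by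
    rw [← hmass, ← integral_sub iρ iu]
    exact (abs_integral_le_integral_abs).trans hclose
  obtain ⟨w, hwc, hwab, hwi, hwb, hwm⟩ := exists_mono hK hKd hh hr huc huab
  have := bil_le_of_mono hK hKd hh.measurable hr hM hM0 hwc.measurable ha hab hwab hwm c
  rw [hwi] at this
  have h3 : 2 * D * |∫ x, (if c ≤ h x then b else a) ∂ν - ∫ x, u x ∂ν| ≤ 2 * D * η := by gcongr
  have h4 : (4 * D + 1) * η = ε := by rw [hη]; field_simp
  have h5 : 4 * D * η ≤ ε := by nlinarith
  linarith

end abstractpart2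

end partC

section partD


open MeasureTheory Metric Set Filter
open scoped ENNReal NNReal Topology RealInnerProductSpace BoundedContinuousFunction

section spherepart

variable {d : ℕ}

/-- The unit sphere as a type. -/
abbrev Sph (d : ℕ) : Type := sphere (0 : EuclideanSpace ℝ (Fin (d+1))) 1

/-- The reflection orthogonal to `a`. -/
def reflE (a : EuclideanSpace ℝ (Fin (d+1))) :
    EuclideanSpace ℝ (Fin (d+1)) ≃ₗᵢ[ℝ] EuclideanSpace ℝ (Fin (d+1)) :=
  Submodule.reflection (ℝ ∙ a)ᗮ

lemma reflE_apply (a z : EuclideanSpace ℝ (Fin (d+1))) :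
    reflE a z = z - (2 * (⟪a, z⟫ / ‖a‖ ^ 2)) • a := by
  unfold reflE
  rw [Submodule.reflection_orthogonal_apply, Submodule.reflection_singleton_apply]
  simp [two_smul, two_mul, add_smul]

/-- The reflection orthogonal to `a` on the sphere. -/
def reflS (a : EuclideanSpace ℝ (Fin (d+1))) : Sph d ≃ᵢ Sph d where
  toFun x := ⟨reflE a x, by simp⟩
  invFun x := ⟨reflE a x, by simp⟩
  left_inv x := Subtype.ext (by simp [reflE])
  right_inv x := Subtype.ext (by simp [reflE])
  isometry_toFun x y := (reflE a).isometry x y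

lemma reflS_coe (a : EuclideanSpace ℝ (Fin (d+1))) (x : Sph d) :
    ((reflS a x : Sph d) : EuclideanSpace ℝ (Fin (d+1))) = reflE a x := rfl

lemma reflS_swap (x y : Sph d) :
    reflS ((x : EuclideanSpace ℝ (Fin (d+1))) - (y : EuclideanSpace ℝ (Fin (d+1)))) x = y := by
  apply Subtype.ext
  rw [reflS_coe]
  exact Submodule.reflection_sub (by simp)

/-- The reflection swapping `x` and `y`. -/
def sphRefl (e : EuclideanSpace ℝ (Fin (d+1))) (x y : Sph d)
    (hxy : (⟪(y : EuclideanSpace ℝ (Fin (d+1))), e⟫ : ℝ) < ⟪(x : EuclideanSpace ℝ (Fin (d+1))), e⟫) :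
    Refl (μH[d] : Measure (Sph d))
      (fun z : Sph d => (⟪(z : EuclideanSpace ℝ (Fin (d+1))), e⟫ : ℝ)) where
  σ := reflS ((x : EuclideanSpace ℝ (Fin (d+1))) - (y : EuclideanSpace ℝ (Fin (d+1))))
  p := fun z => ⟪(x : EuclideanSpace ℝ (Fin (d+1))) - (y : EuclideanSpace ℝ (Fin (d+1))), (z : EuclideanSpace ℝ (Fin (d+1)))⟫
  invol := (reflS _).left_inv
  iso := (reflS _).isometry.dist_eq
  mp := (reflS _).measurePreserving_hausdorffMeasure _
  p_neg := by
    intro z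
    have ha : ‖(x : EuclideanSpace ℝ (Fin (d+1))) - (y : EuclideanSpace ℝ (Fin (d+1)))‖ ^ 2 ≠ 0 := by
      have : (x : EuclideanSpace ℝ (Fin (d+1))) - (y : EuclideanSpace ℝ (Fin (d+1))) ≠ 0 := by
        intro h0
        rw [sub_eq_zero] at h0
        rw [h0] at hxy
        exact lt_irrefl _ hxy
      simpa using this
    rw [reflS_coe, reflE_apply, inner_sub_right, inner_smul_right, real_inner_self_eq_norm_sq]
    rw [mul_assoc, div_mul_cancel₀ _ ha]
    ring
  fixed := by
    intro z hz
    apply Subtype.ext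
    rw [reflS_coe, reflE_apply, hz]
    simp
  closer := by
    intro z w hz hw
    rw [Subtype.dist_eq, Subtype.dist_eq, reflS_coe, reflE_apply, dist_eq_norm, dist_eq_norm]
    generalize (x : EuclideanSpace ℝ (Fin (d+1))) - (y : EuclideanSpace ℝ (Fin (d+1))) = a at *
    refine le_of_sq_le_sq ?_ (norm_nonneg _)
    have e1 : (z : EuclideanSpace ℝ (Fin (d+1))) -
      ((w : EuclideanSpace ℝ (Fin (d+1))) - (2 * (⟪a, (w : EuclideanSpace ℝ (Fin (d+1)))⟫ / ‖a‖ ^ 2)) • a)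
      = (z - w) + (2 * (⟪a, (w : EuclideanSpace ℝ (Fin (d+1)))⟫ / ‖a‖ ^ 2)) • a := by abel
    rw [e1, norm_add_sq_real, inner_smul_right, norm_smul, mul_pow, inner_sub_left,
      Real.norm_eq_abs, sq_abs, real_inner_comm a (z : EuclideanSpace ℝ (Fin (d+1))), real_inner_comm a (w : EuclideanSpace ℝ (Fin (d+1)))]
    by_cases ha : a = 0
    · simp [ha]
    have ha' : 0 < ‖a‖ := norm_pos_iff.2 ha
    set α := (⟪a, (w : EuclideanSpace ℝ (Fin (d+1)))⟫ : ℝ)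
    set β := (⟪a, (z : EuclideanSpace ℝ (Fin (d+1)))⟫ : ℝ)
    have : 2 * (2 * (α / ‖a‖ ^ 2) * (β - α)) + (2 * (α / ‖a‖ ^ 2)) ^ 2 * ‖a‖ ^ 2 =
      4 * (α * β) / ‖a‖ ^ 2 := by field_simp; ring
    have h2 : 0 ≤ 4 * (α * β) / ‖a‖ ^ 2 := by positivity
    linarith
  height := by
    intro z hz
    rw [reflS_coe, reflE_apply, inner_sub_left, inner_smul_left]
    have h1 : 0 < (⟪(x : EuclideanSpace ℝ (Fin (d+1))) - (y : EuclideanSpace ℝ (Fin (d+1))), e⟫ : ℝ) := by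
      rw [inner_sub_left]; linarith
    generalize (x : EuclideanSpace ℝ (Fin (d+1))) - (y : EuclideanSpace ℝ (Fin (d+1))) = a at *
    have ha : a ≠ 0 := by rintro rfl; simp at h1
    have ha' : 0 < ‖a‖ := norm_pos_iff.2 ha
    have : 0 < 2 * (⟪a, (z : EuclideanSpace ℝ (Fin (d+1)))⟫ / ‖a‖ ^ 2) := by positivity
    simp only [conj_trivial]
    nlinarith

lemma sphRefl_exists (e : EuclideanSpace ℝ (Fin (d+1))) (x y : Sph d)
    (hxy : (⟪(y : EuclideanSpace ℝ (Fin (d+1))), e⟫ : ℝ) < ⟪(x : EuclideanSpace ℝ (Fin (d+1))), e⟫) :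
    ∃ r : Refl (μH[d] : Measure (Sph d))
      (fun z : Sph d => (⟪(z : EuclideanSpace ℝ (Fin (d+1))), e⟫ : ℝ)), r.σ x = y ∧ 0 < r.p x := by
  refine ⟨sphRefl e x y hxy, reflS_swap x y, ?_⟩
  change 0 < (⟪(x : EuclideanSpace ℝ (Fin (d+1))) - (y : EuclideanSpace ℝ (Fin (d+1))), (x : EuclideanSpace ℝ (Fin (d+1)))⟫ : ℝ)
  have hx : ‖(x : EuclideanSpace ℝ (Fin (d+1)))‖ = 1 := by simp
  have hy : ‖(y : EuclideanSpace ℝ (Fin (d+1)))‖ = 1 := by simp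
  rw [inner_sub_left, real_inner_self_eq_norm_sq, hx]
  have hne : (y : EuclideanSpace ℝ (Fin (d+1))) ≠ x := by
    intro h0; rw [h0] at hxy; exact lt_irrefl _ hxy
  have := inner_lt_one_iff_real_of_norm_eq_one hy hx |>.2 hne
  linarith

lemma sph_openPos (h0 : (μH[d] : Measure (Sph d)) univ ≠ 0) :
    (μH[d] : Measure (Sph d)).IsOpenPosMeasure := by
  refine ⟨fun U hU hne hz => h0 ?_⟩
  obtain ⟨y, hy⟩ := hne
  refine measure_null_of_locally_null _ fun x _ => ?_
  set R := reflS ((x : EuclideanSpace ℝ (Fin (d+1))) - (y : EuclideanSpace ℝ (Fin (d+1)))) with hR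
  refine ⟨R ⁻¹' U, mem_nhdsWithin_of_mem_nhds ?_, ?_⟩
  · exact (hU.preimage R.continuous).mem_nhds (by simpa [hR, reflS_swap] using hy)
  · rw [R.hausdorffMeasure_preimage, hz]

lemma cone_null (x : EuclideanSpace ℝ (Fin (d+1))) (hx : ‖x‖ = 1) (c : ℝ) (hc : |c| < 1) :
    volume {z : EuclideanSpace ℝ (Fin (d+1)) | (⟪x, z⟫ : ℝ) = c * ‖z‖} = 0 := by
  refine Measure.addHaar_eq_zero_of_disjoint_translates volume
    (fun n : ℕ => ((1 / 2 : ℝ) ^ n) • x) ?_ ?_ ?_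
  · rw [isBounded_iff_forall_norm_le]
    refine ⟨1, ?_⟩
    rintro _ ⟨n, rfl⟩
    simp only [norm_smul, hx, mul_one, norm_pow]
    exact pow_le_one₀ (by positivity) (by norm_num)
  · intro m n hmn
    simp only [Function.onFun, singleton_add, image_add_left, disjoint_left, mem_preimage,
      mem_ofPred_eq]
    intro z hm hn
    have hne : (1 / 2 : ℝ) ^ m ≠ (1 / 2 : ℝ) ^ n := by
      intro h
      exact hmn (pow_right_injective₀ (by norm_num) (by norm_num) h)
    set s := (1 / 2 : ℝ) ^ m
    set t := (1 / 2 : ℝ) ^ n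
    rw [inner_add_right, inner_neg_right, inner_smul_right, real_inner_self_eq_norm_sq, hx] at hm hn
    have h1 : t - s = c * (‖-(s • x) + z‖ - ‖-(t • x) + z‖) := by linarith
    have h2 : |‖-(s • x) + z‖ - ‖-(t • x) + z‖| ≤ |t - s| := by
      refine (abs_norm_sub_norm_le _ _).trans ?_
      have : -(s • x) + z - (-(t • x) + z) = (t - s) • x := by rw [sub_smul]; abel
      rw [this, norm_smul, hx, mul_one, Real.norm_eq_abs]
    have h3 : |t - s| = |c| * |‖-(s • x) + z‖ - ‖-(t • x) + z‖| := by rw [← abs_mul, ← h1]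
    have h4 : 0 < |t - s| := abs_pos.2 (sub_ne_zero.2 hne.symm)
    nlinarith [abs_nonneg c, abs_nonneg (‖-(s • x) + z‖ - ‖-(t • x) + z‖)]
  · exact (isClosed_eq (by fun_prop) (by fun_prop)).measurableSet

lemma slice_null (hd : 0 < d) [IsFiniteMeasure (μH[d] : Measure (Sph d))]
    (e : EuclideanSpace ℝ (Fin (d+1))) (he : ‖e‖ = 1) (c : ℝ) :
    (μH[d] : Measure (Sph d)) {x | (⟪(x : EuclideanSpace ℝ (Fin (d+1))), e⟫ : ℝ) = c} = 0 := by
  have hna : NullSingletonClass (μH[d] : Measure (Sph d)) :=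
    Measure.nullSingletonClass_hausdorff _ (by exact_mod_cast hd)
  have hn : ∀ x : Sph d, ‖(x : EuclideanSpace ℝ (Fin (d+1)))‖ = 1 := fun x => by simp
  rcases lt_or_ge |c| 1 with hc | hc
  · set ν := (μH[d] : Measure (Sph d)) with hν
    set T : Set (EuclideanSpace ℝ (Fin (d+1)) × Sph d) :=
      {z | (⟪(z.2 : EuclideanSpace ℝ (Fin (d+1))), z.1⟫ : ℝ) = c * ‖z.1‖} with hT
    have hTm : MeasurableSet T := (isClosed_eq (by fun_prop) (by fun_prop)).measurableSet
    have h0 : (volume.prod ν) T = 0 := by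
      rw [Measure.prod_apply_symm hTm]
      simp only [lintegral_eq_zero_iff', hT, preimage_ofPred_eq]
      simp [cone_null _ (hn _) c hc]
    rw [Measure.measure_prod_null hTm] at h0
    have h1 : ∀ᵐ z : EuclideanSpace ℝ (Fin (d+1)), z ≠ 0 := by
      have : (volume : Measure (EuclideanSpace ℝ (Fin (d+1)))) {0} = 0 := measure_singleton _
      exact compl_mem_ae_iff.2 this
    obtain ⟨z, hz, hz0⟩ := (h0.and h1).exists
    simp only [Pi.zero_apply, hT, preimage_ofPred_eq] at hz
    have hzn : 0 < ‖z‖ := norm_pos_iff.2 hz0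
    set z' : EuclideanSpace ℝ (Fin (d+1)) := ‖z‖⁻¹ • z with hz'
    have hz'n : ‖z'‖ = 1 := by rw [hz', norm_smul, norm_inv, norm_norm]; field_simp
    set R := reflS (d := d) (z' - e) with hR
    rw [← R.hausdorffMeasure_preimage]  at hz
    rw [← hz]
    congr 1
    ext x
    simp only [mem_preimage, mem_ofPred_eq]
    rw [hR, reflS_coe]
    have e2 : reflE (z' - e) z' = e := Submodule.reflection_sub (by rw [hz'n, he])
    have e3 : z = ‖z‖ • z' := by rw [hz', smul_smul, mul_inv_cancel₀ hzn.ne', one_smul]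
    have e5 : reflE (z' - e) e = z' := by
      have := congrArg (reflE (z' - e)) e2
      rw [← this]
      simp [reflE]
    have e4 : (⟪reflE (z' - e) x, z⟫ : ℝ) = ‖z‖ * ⟪(x : EuclideanSpace ℝ (Fin (d+1))), e⟫ := by
      generalize z' - e = A at e5
      conv_lhs => rw [e3]
      rw [inner_smul_right, ← e5, LinearIsometryEquiv.inner_map_map]
    rw [e4, mul_comm c]
    constructor
    · rintro rfl; rfl
    · intro h; exact mul_left_cancel₀ hzn.ne' h
  · have hsub : {x : Sph d | (⟪(x : EuclideanSpace ℝ (Fin (d+1))), e⟫ : ℝ) = c} ⊆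
        {⟨e, by simp [he]⟩, ⟨-e, by simp [he]⟩} := by
      intro x hx
      simp only [mem_ofPred_eq] at hx
      have h1 : |c| ≤ 1 := by
        have := abs_real_inner_le_norm (x : EuclideanSpace ℝ (Fin (d+1))) e
        rwa [hx, hn, he, one_mul] at this
      simp only [mem_insert_iff, mem_singleton_iff]
      rcases eq_or_eq_neg_of_abs_eq (le_antisymm h1 hc) with h2 | h2
      · left
        apply Subtype.ext
        exact (inner_eq_one_iff_of_norm_eq_one (𝕜 := ℝ) (hn x) he).1 (hx.trans h2)
      · right
        apply Subtype.ext
        refine (inner_eq_one_iff_of_norm_eq_one (𝕜 := ℝ) (hn x) (by simpa using he)).1 ?_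
        rw [inner_neg_right, hx, h2]; simp
    refine measure_mono_null hsub ?_
    exact (Set.Countable.measure_zero (by simp) _)

end spherepart

end partD

section finalpart

lemma cm_ext {f : ℝ → ℝ} (hf : CompletelyMonotone f) {M : ℝ} (hM : ∀ t, 0 < t → t ≤ 2 → f t ≤ M) :
    ∃ g : ℝ → ℝ, Continuous g ∧ Antitone g ∧ ∀ t, 0 < t → g t = f t := by
  obtain ⟨hcd, hs⟩ := hf
  have hdiff : DifferentiableOn ℝ f (Ioi 0) := hcd.differentiableOn (by simp)
  have hanti : AntitoneOn f (Ioi 0) := by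
    refine antitoneOn_of_deriv_nonpos (convex_Ioi 0) hdiff.continuousOn
      (by rwa [interior_Ioi]) ?_
    intro t ht
    rw [interior_Ioi] at ht
    have := hs 1 t ht
    rw [iteratedDerivWithin_one, derivWithin_of_isOpen isOpen_Ioi ht] at this
    linarith
  have hbdd : BddAbove (f '' Ioi 0) := ⟨M, by
    rintro _ ⟨t, ht, rfl⟩
    rcases le_total t 2 with h2 | h2
    · exact hM t ht h2
    · exact (hanti (mem_Ioi.2 two_pos) ht h2).trans (hM 2 two_pos le_rfl)⟩
  set L := sSup (f '' Ioi 0) with hL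
  set g : ℝ → ℝ := fun t => if t ≤ 0 then L else f t with hg
  have hgf : ∀ t, 0 < t → g t = f t := fun t ht => by simp [hg, not_le.2 ht]
  have hg0 : ∀ t, t ≤ 0 → g t = L := fun t ht => by simp [hg, ht]
  have ganti : Antitone g := by
    intro s t hst
    rcases le_or_gt t 0 with ht | ht
    · rw [hg0 t ht, hg0 s (hst.trans ht)]
    · rw [hgf t ht]
      rcases le_or_gt s 0 with h0 | h0
      · rw [hg0 s h0]; exact le_csSup hbdd ⟨t, ht, rfl⟩
      · rw [hgf s h0]; exact hanti h0 ht hst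
  refine ⟨g, ?_, ganti, hgf⟩
  rw [continuous_iff_continuousAt]
  intro t
  rcases lt_trichotomy t 0 with ht | rfl | ht
  · have : g =ᶠ[𝓝 t] fun _ => L := by
      filter_upwards [Iio_mem_nhds ht] with s hs using hg0 s (le_of_lt hs)
    exact continuousAt_const.congr this.symm
  · rw [continuousAt_iff_continuous_left'_right']
    constructor
    · refine (continuousWithinAt_const (b := L)).congr ?_ ?_
      · intro s hs; exact hg0 s (le_of_lt hs)
      · exact hg0 0 le_rfl
    · have h1 := ganti.tendsto_nhdsGT 0
      have h2 : g '' Ioi 0 = f '' Ioi 0 := image_congr fun s hs => hgf s hs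
      rw [h2, ← hL, ← hg0 0 le_rfl] at h1
      exact h1
  · have : g =ᶠ[𝓝 t] f := by
      filter_upwards [Ioi_mem_nhds ht] with s hs using hgf s hs
    exact (hdiff.continuousOn.continuousAt (Ioi_mem_nhds ht)).congr this.symm

lemma sph_dist {d : ℕ} (hd : 0 < d) {t : ℝ} (ht : t ∈ Icc (0:ℝ) 2) :
    ∃ x ∈ sphere (0 : EuclideanSpace ℝ (Fin (d+1))) 1,
      ∃ y ∈ sphere (0 : EuclideanSpace ℝ (Fin (d+1))) 1, dist x y = t := by
  set e : EuclideanSpace ℝ (Fin (d+1)) := EuclideanSpace.single 0 1 with he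
  have hen : ‖e‖ = 1 := by simp [he]
  have hc : IsPreconnected (sphere (0 : EuclideanSpace ℝ (Fin (d+1))) 1) := by
    refine isPreconnected_sphere ?_ _ _
    exact Module.one_lt_rank_of_one_lt_finrank (by simp; omega)
  have h1 : e ∈ sphere (0 : EuclideanSpace ℝ (Fin (d+1))) 1 := by simp [hen]
  have h2 : -e ∈ sphere (0 : EuclideanSpace ℝ (Fin (d+1))) 1 := by simp [hen]
  have h3 := hc.intermediate_value h1 h2 (f := fun y => dist e y) (by fun_prop)
  have h4 : dist e (-e) = 2 := by
    rw [dist_eq_norm, sub_neg_eq_add, ← two_smul ℝ, norm_smul, hen]; norm_num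
  simp only [dist_self, h4] at h3
  obtain ⟨y, hy, hyt⟩ := h3 ht
  exact ⟨e, h1, y, hy, hyt⟩

lemma f_bound {d : ℕ} (hd : 0 < d) {f : ℝ → ℝ}
    {k : EuclideanSpace ℝ (Fin (d+1)) → EuclideanSpace ℝ (Fin (d+1)) → ℝ}
    (hkf : ∀ x ∈ sphere (0 : EuclideanSpace ℝ (Fin (d+1))) 1,
      ∀ y ∈ sphere (0 : EuclideanSpace ℝ (Fin (d+1))) 1, k x y = f (dist x y))
    (hpd : IsPosDefKernel (sphere (0 : EuclideanSpace ℝ (Fin (d+1))) 1) k)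
    {t : ℝ} (h0 : 0 < t) (h2 : t ≤ 2) : f t ≤ f 0 := by
  obtain ⟨x, hx, y, hy, hxy⟩ := sph_dist hd ⟨h0.le, h2⟩
  have hne : x ≠ y := by rintro rfl; simp at hxy; linarith
  have := hpd 2 ![x, y] (by intro i; fin_cases i <;> simp_all)
    (by
      intro i j hij
      fin_cases i <;> fin_cases j <;> simp_all)
    ![1, -1] (by intro h; simpa using congrFun h 0)
  simp only [Fin.sum_univ_two, Matrix.cons_val_zero, Matrix.cons_val_one] at this
  rw [hkf x hx x hx, hkf x hx y hy, hkf y hy x hx, hkf y hy y hy, dist_self, dist_self,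
    dist_comm y x, hxy] at this
  simp at this
  linarith

lemma sph_map (d : ℕ) : Measure.map (Subtype.val : Sph d → EuclideanSpace ℝ (Fin (d+1))) μH[d] =
    (μH[d]).restrict (sphere (0 : EuclideanSpace ℝ (Fin (d+1))) 1) := by
  rw [isometry_subtype_coe.map_hausdorffMeasure (Or.inl (Nat.cast_nonneg d)), Subtype.range_coe]

lemma sph_emb (d : ℕ) :
    MeasurableEmbedding (Subtype.val : Sph d → EuclideanSpace ℝ (Fin (d+1))) :=
  MeasurableEmbedding.subtype_coe isClosed_sphere.measurableSet

lemma int_sph {d : ℕ} (F : EuclideanSpace ℝ (Fin (d+1)) → ℝ) :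
    ∫ x in sphere (0 : EuclideanSpace ℝ (Fin (d+1))) 1, F x ∂μH[d] =
      ∫ x : Sph d, F x ∂μH[d] := by
  rw [← sph_map, (sph_emb d).integral_map]

lemma meas_sph {d : ℕ} (s : Set (EuclideanSpace ℝ (Fin (d+1))))  :
    (μH[d]) (s ∩ sphere (0 : EuclideanSpace ℝ (Fin (d+1))) 1) =
      (μH[d] : Measure (Sph d)) (Subtype.val ⁻¹' s) := by
  rw [isometry_subtype_coe.hausdorffMeasure_preimage (Or.inl (Nat.cast_nonneg d)),
    Subtype.range_coe]

lemma ae_sph {d : ℕ} {p : EuclideanSpace ℝ (Fin (d+1)) → Prop} :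
    (∀ᵐ x ∂((μH[d]).restrict (sphere (0 : EuclideanSpace ℝ (Fin (d+1))) 1)), p x) ↔
      ∀ᵐ x : Sph d ∂μH[d], p x := by
  rw [← sph_map, (sph_emb d).ae_map_iff]

lemma energy_eq {d : ℕ} (hd : 0 < d) [IsFiniteMeasure (μH[d] : Measure (Sph d))] {f g : ℝ → ℝ}
    {k : EuclideanSpace ℝ (Fin (d+1)) → EuclideanSpace ℝ (Fin (d+1)) → ℝ}
    (hkf : ∀ x ∈ sphere (0 : EuclideanSpace ℝ (Fin (d+1))) 1,
      ∀ y ∈ sphere (0 : EuclideanSpace ℝ (Fin (d+1))) 1, k x y = f (dist x y))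
    (hg : Continuous g) (hgf : ∀ t, 0 < t → g t = f t)
    {ρ : EuclideanSpace ℝ (Fin (d+1)) → ℝ} {u : Sph d → ℝ} (hu : Measurable u)
    {b : ℝ} (hub : ∀ x, |u x| ≤ b) (hρu : ∀ᵐ x : Sph d ∂μH[d], ρ x = u x) :
    energy (μH[d]) (sphere (0 : EuclideanSpace ℝ (Fin (d+1))) 1) k ρ =
      (1 / 2) * bil (μH[d] : Measure (Sph d)) (fun x y => g (dist x y)) u u := by
  have hna : NullSingletonClass (μH[d] : Measure (Sph d)) :=
    Measure.nullSingletonClass_hausdorff _ (by exact_mod_cast hd)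
  unfold energy bil
  congr 1
  rw [integral_prod _ (bil_integrable (K := fun x y : Sph d => g (dist x y)) (by
    unfold Function.uncurry; fun_prop) hu hu hub hub), int_sph]
  refine integral_congr_ae ?_
  filter_upwards [hρu] with x hx
  rw [int_sph]
  refine integral_congr_ae ?_
  have hne : ∀ᵐ y : Sph d ∂μH[d], y ≠ x := compl_mem_ae_iff.2 (measure_singleton x)
  filter_upwards [hρu, hne] with y hy hyx
  rw [hx, hy, hkf x x.2 y y.2, hgf _ (dist_pos.2 hyx.symm)]
  rfl

lemma cap_cont {d : ℕ} (hd : 0 < d) [IsFiniteMeasure (μH[d] : Measure (Sph d))]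
    (e : EuclideanSpace ℝ (Fin (d+1))) (he : ‖e‖ = 1) (a b : ℝ) :
    Continuous fun c : ℝ => ∫ x : Sph d,
      (if c ≤ (⟪(x : EuclideanSpace ℝ (Fin (d+1))), e⟫ : ℝ) then b else a) ∂μH[d] := by
  rw [continuous_iff_continuousAt]
  intro c
  have hm : ∀ c : ℝ, Measurable fun x : Sph d =>
      (if c ≤ (⟪(x : EuclideanSpace ℝ (Fin (d+1))), e⟫ : ℝ) then b else a) := fun c =>
    Measurable.ite (isClosed_le (by fun_prop) (by fun_prop)).measurableSet
      measurable_const measurable_const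
  refine continuousAt_of_dominated (bound := fun _ => max |b| |a|)
    (Eventually.of_forall fun c => (hm c).aestronglyMeasurable) ?_ (integrable_const _) ?_
  · refine Eventually.of_forall fun c => ae_of_all _ fun x => ?_
    split_ifs
    · exact le_max_left _ _
    · exact le_max_right _ _
  · have hne : ∀ᵐ x : Sph d ∂μH[d], (⟪(x : EuclideanSpace ℝ (Fin (d+1))), e⟫ : ℝ) ≠ c :=
      compl_mem_ae_iff.2 (slice_null hd e he c)
    filter_upwards [hne] with x hx
    rcases lt_or_gt_of_ne hx with h | h
    · refine (continuousAt_const (y := a)).congr ?_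
      filter_upwards [Ioi_mem_nhds h] with s hs
      rw [if_neg (not_le.2 hs)]
    · refine (continuousAt_const (y := b)).congr ?_
      filter_upwards [Iio_mem_nhds h] with s hs
      rw [if_pos (le_of_lt hs)]

lemma cap_exists {d : ℕ} (hd : 0 < d) [IsFiniteMeasure (μH[d] : Measure (Sph d))]
    (e : EuclideanSpace ℝ (Fin (d+1))) (he : ‖e‖ = 1) (a b : ℝ)
    (ha : a * (μH[d] : Measure (Sph d)).real univ ≤ 1)
    (hb : 1 ≤ b * (μH[d] : Measure (Sph d)).real univ) :
    ∃ c ∈ Icc (-1:ℝ) 1, ∫ x : Sph d,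
      (if c ≤ (⟪(x : EuclideanSpace ℝ (Fin (d+1))), e⟫ : ℝ) then b else a) ∂μH[d] = 1 := by
  have hin : ∀ x : Sph d, |(⟪(x : EuclideanSpace ℝ (Fin (d+1))), e⟫ : ℝ)| ≤ 1 := fun x => by
    have := abs_real_inner_le_norm (x : EuclideanSpace ℝ (Fin (d+1))) e
    rwa [he, show ‖(x : EuclideanSpace ℝ (Fin (d+1)))‖ = 1 by simp, one_mul] at this
  have h := intermediate_value_Icc' (show (-1:ℝ) ≤ 1 by norm_num)
    (cap_cont hd e he a b).continuousOn
  have h1 : ∫ x : Sph d, (if (-1:ℝ) ≤ (⟪(x : EuclideanSpace ℝ (Fin (d+1))), e⟫ : ℝ) then b else a)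
      ∂μH[d] = b * (μH[d] : Measure (Sph d)).real univ := by
    rw [integral_congr_ae (g := fun _ => b) (ae_of_all _ fun x => if_pos (abs_le.1 (hin x)).1)]
    simp [mul_comm]
  have h2 : ∫ x : Sph d, (if (1:ℝ) ≤ (⟪(x : EuclideanSpace ℝ (Fin (d+1))), e⟫ : ℝ) then b else a)
      ∂μH[d] = a * (μH[d] : Measure (Sph d)).real univ := by
    have hne : ∀ᵐ x : Sph d ∂μH[d], (⟪(x : EuclideanSpace ℝ (Fin (d+1))), e⟫ : ℝ) ≠ 1 :=
      compl_mem_ae_iff.2 (slice_null hd e he 1)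
    rw [integral_congr_ae (g := fun _ => a) (by
      filter_upwards [hne] with x hx
      exact if_neg (not_le.2 (lt_of_le_of_ne (abs_le.1 (hin x)).2 hx)))]
    simp [mul_comm]
  rw [h1, h2] at h
  obtain ⟨c, hc, hc1⟩ := h ⟨ha, hb⟩
  exact ⟨c, hc, hc1⟩

end finalpart

/-- On the unit sphere `S^d ⊆ ℝ^{d+1}`, the density problem is solved
by a density equal to `ρ₊` on a spherical cap and `ρ₋` on its complement. -/
theorem stmt_7 (d : ℕ) (hd : 0 < d)
    (f : ℝ → ℝ)
    (k : EuclideanSpace ℝ (Fin (d+1)) → EuclideanSpace ℝ (Fin (d+1)) → ℝ)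
    (hkf : ∀ x ∈ sphere (0 : EuclideanSpace ℝ (Fin (d+1))) 1,
      ∀ y ∈ sphere (0 : EuclideanSpace ℝ (Fin (d+1))) 1, k x y = f (dist x y))
    (hkpos : ∀ x ∈ sphere (0 : EuclideanSpace ℝ (Fin (d+1))) 1,
      ∀ y ∈ sphere (0 : EuclideanSpace ℝ (Fin (d+1))) 1, 0 < k x y)
    (hf : CompletelyMonotone f)
    (hpd : IsPosDefKernel (sphere (0 : EuclideanSpace ℝ (Fin (d+1))) 1) k)
    (hint : Integrable
      (fun z : EuclideanSpace ℝ (Fin (d+1)) × EuclideanSpace ℝ (Fin (d+1)) => k z.1 z.2)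
      (((μH[d]).restrict (sphere (0 : EuclideanSpace ℝ (Fin (d+1))) 1)).prod
        ((μH[d]).restrict (sphere (0 : EuclideanSpace ℝ (Fin (d+1))) 1))))
    (ρp ρm : ℝ) (hρm : 0 < ρm)
    (hρm' : ρm ≤ ((μH[d]) (sphere (0 : EuclideanSpace ℝ (Fin (d+1))) 1)).toReal⁻¹)
    (hρp : ((μH[d]) (sphere (0 : EuclideanSpace ℝ (Fin (d+1))) 1)).toReal⁻¹ ≤ ρp) :
    ∃ (e : EuclideanSpace ℝ (Fin (d+1))) (c : ℝ), ‖e‖ = 1 ∧ c ∈ Set.Icc (-1:ℝ) 1 ∧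
      ρp * ((μH[d]) {x | x ∈ sphere (0 : EuclideanSpace ℝ (Fin (d+1))) 1 ∧ c ≤ ⟪x, e⟫}).toReal
        + ρm * ((μH[d]) ((sphere (0 : EuclideanSpace ℝ (Fin (d+1))) 1) \
            {x | c ≤ ⟪x, e⟫})).toReal = 1 ∧
      IsAdmissible (μH[d]) (sphere (0 : EuclideanSpace ℝ (Fin (d+1))) 1) ρp ρm
        (fun x => if c ≤ ⟪x, e⟫ then ρp else ρm) ∧
      ∀ ρ, IsAdmissible (μH[d]) (sphere (0 : EuclideanSpace ℝ (Fin (d+1))) 1) ρp ρm ρ →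
        energy (μH[d]) (sphere (0 : EuclideanSpace ℝ (Fin (d+1))) 1) k ρ ≤
          energy (μH[d]) (sphere (0 : EuclideanSpace ℝ (Fin (d+1))) 1) k
            (fun x => if c ≤ ⟪x, e⟫ then ρp else ρm) := by
  set S := sphere (0 : EuclideanSpace ℝ (Fin (d+1))) 1 with hS
  have hinv : 0 < ((μH[d]) S).toReal⁻¹ := hρm.trans_le hρm'
  have hV : 0 < ((μH[d]) S).toReal := inv_pos.1 hinv
  have hfin : (μH[d]) S ≠ ∞ := by intro h; rw [h] at hV; simp at hV
  have hSν : (μH[d]) S = (μH[d] : Measure (Sph d)) univ := by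
    have := meas_sph (d := d) univ
    rwa [univ_inter, preimage_univ] at this
  have hF : IsFiniteMeasure (μH[d] : Measure (Sph d)) :=
    ⟨by rw [← hSν]; exact hfin.lt_top⟩
  have hO : (μH[d] : Measure (Sph d)).IsOpenPosMeasure := sph_openPos (by
    rw [← hSν]; intro h; rw [h] at hV; simp at hV)
  have hVr : (μH[d] : Measure (Sph d)).real univ = ((μH[d]) S).toReal := by
    rw [hSν]; rfl
  obtain ⟨g, hgc, hga, hgf⟩ := cm_ext hf (M := f 0) fun t h0 h2 => f_bound hd hkf hpd h0 h2
  set e : EuclideanSpace ℝ (Fin (d+1)) := EuclideanSpace.single 0 1 with he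
  have hen : ‖e‖ = 1 := by simp [he]
  obtain ⟨c, hc, hc1⟩ := cap_exists hd e hen ρm ρp
    (by rw [hVr]; calc _ ≤ ((μH[d]) S).toReal⁻¹ * ((μH[d]) S).toReal := by gcongr
                    _ = 1 := inv_mul_cancel₀ hV.ne')
    (by rw [hVr]; calc 1 = ((μH[d]) S).toReal⁻¹ * ((μH[d]) S).toReal := (inv_mul_cancel₀ hV.ne').symm
                    _ ≤ _ := by gcongr)
  have hle : ρm ≤ ρp := hρm'.trans hρp
  have hmE : Measurable (fun x : EuclideanSpace ℝ (Fin (d+1)) =>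
      if c ≤ (⟪x, e⟫ : ℝ) then ρp else ρm) :=
    Measurable.ite (isClosed_le (by fun_prop) (by fun_prop)).measurableSet
      measurable_const measurable_const
  have hmS : Measurable (fun x : Sph d =>
      if c ≤ (⟪(x : EuclideanSpace ℝ (Fin (d+1))), e⟫ : ℝ) then ρp else ρm) :=
    hmE.comp measurable_subtype_coe
  have hbd : ∀ x : EuclideanSpace ℝ (Fin (d+1)), ρm ≤ (if c ≤ (⟪x, e⟫ : ℝ) then ρp else ρm) ∧
      (if c ≤ (⟪x, e⟫ : ℝ) then ρp else ρm) ≤ ρp := fun x => by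
    split_ifs
    · exact ⟨hle, le_rfl⟩
    · exact ⟨le_rfl, hle⟩
  have habs : ∀ r : ℝ, ρm ≤ r ∧ r ≤ ρp → |r| ≤ ρp := fun r hr => by
    rw [abs_of_nonneg (hρm.le.trans hr.1)]; exact hr.2
  refine ⟨e, c, hen, hc, ?_, ⟨hmE.aestronglyMeasurable, ?_, ae_of_all _ hbd⟩, ?_⟩
  · set T : Set (EuclideanSpace ℝ (Fin (d+1))) := {x | c ≤ (⟪x, e⟫ : ℝ)} with hT
    have hTm : MeasurableSet T := (isClosed_le (by fun_prop) (by fun_prop)).measurableSet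
    have e1 : {x | x ∈ S ∧ c ≤ (⟪x, e⟫ : ℝ)} = T ∩ S := by
      ext x; exact and_comm
    have e2 : S \ T = Tᶜ ∩ S := by
      rw [sdiff_eq, inter_comm]
    rw [e1, e2, meas_sph, meas_sph, preimage_compl]
    set T' : Set (Sph d) := Subtype.val ⁻¹' T with hT'
    have hTm' : MeasurableSet T' := measurable_subtype_coe hTm
    have e3 : (fun x : Sph d => if c ≤ (⟪(x : EuclideanSpace ℝ (Fin (d+1))), e⟫ : ℝ)
        then ρp else ρm) = T'.indicator (fun _ => ρp) + T'ᶜ.indicator (fun _ => ρm) := by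
      ext x
      by_cases hx : c ≤ (⟪(x : EuclideanSpace ℝ (Fin (d+1))), e⟫ : ℝ)
      · have h1 : x ∈ T' := hx
        simp [hx, h1]
      · have h1 : x ∉ T' := hx
        simp [hx, h1]
    rw [e3, integral_add' ((integrable_const _).indicator hTm')
      ((integrable_const _).indicator hTm'.compl), integral_indicator_const _ hTm',
      integral_indicator_const _ hTm'.compl] at hc1
    rw [smul_eq_mul, smul_eq_mul] at hc1
    rw [mul_comm ρp, mul_comm ρm]
    exact hc1
  · rw [int_sph]; exact hc1
  · rintro ρ ⟨hρ1, hρ2, hρ3⟩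
    rw [ae_sph] at hρ3
    rw [int_sph] at hρ2
    have hae : AEMeasurable (fun x : Sph d => ρ x) μH[d] := by
      have := hρ1.aemeasurable
      rw [← sph_map] at this
      exact this.comp_measurable measurable_subtype_coe
    set u : Sph d → ℝ := fun x => max ρm (min ρp (hae.mk _ x)) with hu
    have hum : Measurable u :=
      measurable_const.max (measurable_const.min hae.measurable_mk)
    have hub : ∀ x, ρm ≤ u x ∧ u x ≤ ρp := fun x =>
      ⟨le_max_left _ _, max_le hle (min_le_left _ _)⟩
    have hρu : ∀ᵐ x : Sph d ∂μH[d], ρ x = u x := by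
      filter_upwards [hρ3, hae.ae_eq_mk] with x h1 h2
      rw [hu]
      simp only
      rw [← h2, min_eq_right h1.2, max_eq_right h1.1]
    rw [energy_eq hd hkf hgc hgf hum (fun x => habs _ (hub x)) hρu,
      energy_eq hd hkf hgc hgf hmS (fun x => habs _ (hbd x)) (ae_of_all _ fun x => rfl)]
    refine mul_le_mul_of_nonneg_left ?_ (by norm_num)
    refine abstract_max (h := fun x : Sph d => (⟪(x : EuclideanSpace ℝ (Fin (d+1))), e⟫ : ℝ))
      (by unfold Function.uncurry; fun_prop) (fun x y x' y' h => hga h) (by fun_prop)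
      (fun x y hxy => sphRefl_exists e x y hxy) hum hρm.le hle hub c ?_
    exact ((integral_congr_ae hρu).symm.trans hρ2).trans hc1.symm

end
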